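/- Let H be a complex Hénon map of degree d. The function G⁺ is pluriharmonic on ℂ² ∖ K⁺: every point of ℂ² ∖ K⁺ has an open neighborhood U ⊂ ℂ² ∖ K⁺ on which G⁺ = Re g for some holomorphic function g : U → ℂ. The analogous statement holds for G⁻ on ℂ² ∖ K⁻. -/

import Mathlib

open Filter Metric Topology Set

noncomputable section

/-- An elementary Hénon map `(z,w) ↦ (P(z) + a·w, b·z)` with `deg P ≥ 2`, `a ≠ 0`, `b ≠ 0`. -/
structure ElemHenon where
  P : Polynomial ℂ
  a : ℂ
  b : ℂ
  ha : a ≠ 0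
  hb : b ≠ 0
  hdeg : 2 ≤ P.natDegree

def ElemHenon.toFun (h : ElemHenon) : ℂ × ℂ → ℂ × ℂ :=
  fun p => (h.P.eval p.1 + h.a * p.2, h.b * p.1)

def ElemHenon.invFun (h : ElemHenon) : ℂ × ℂ → ℂ × ℂ :=
  fun p => (p.2 / h.b, (p.1 - h.P.eval (p.2 / h.b)) / h.a)

/-- A complex Hénon map: a nonempty composition `H = H₁ ∘ ⋯ ∘ Hₙ` of elementary Hénon maps. -/
structure HenonMap where
  comps : List ElemHenon
  ne : comps ≠ []

/-- The map `H = H₁ ∘ ⋯ ∘ Hₙ`. -/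
def HenonMap.toFun (H : HenonMap) : ℂ × ℂ → ℂ × ℂ :=
  H.comps.foldr (fun h f => h.toFun ∘ f) id

/-- The inverse map `H⁻¹ = Hₙ⁻¹ ∘ ⋯ ∘ H₁⁻¹`. -/
def HenonMap.invFun (H : HenonMap) : ℂ × ℂ → ℂ × ℂ :=
  H.comps.foldl (fun f h => h.invFun ∘ f) id

/-- The degree `d = ∏ deg Pᵢ`. -/
def HenonMap.deg (H : HenonMap) : ℕ :=
  (H.comps.map fun h => h.P.natDegree).prod

/-- The (constant) Jacobian determinant of `H`; each factor contributes `-aᵢbᵢ`. -/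
def HenonMap.jacDet (H : HenonMap) : ℂ :=
  (H.comps.map fun h => -(h.a * h.b)).prod

/-- Points with bounded forward orbit. -/
def Kplus (H : HenonMap) : Set (ℂ × ℂ) :=
  {p | Bornology.IsBounded (Set.range fun n : ℕ => H.toFun^[n] p)}

/-- Points with bounded backward orbit. -/
def Kminus (H : HenonMap) : Set (ℂ × ℂ) :=
  {p | Bornology.IsBounded (Set.range fun n : ℕ => H.invFun^[n] p)}

def Jplus (H : HenonMap) : Set (ℂ × ℂ) := frontier (Kplus H)

def Jminus (H : HenonMap) : Set (ℂ × ℂ) := frontier (Kminus H)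

/-- The Julia set `J = J⁺ ∩ J⁻`. -/
def Jset (H : HenonMap) : Set (ℂ × ℂ) := Jplus H ∩ Jminus H

/-- The forward escape function `G⁺(p) = lim d⁻ⁿ log⁺ ‖Hⁿ(p)‖`. -/
def Gplus (H : HenonMap) (p : ℂ × ℂ) : ℝ :=
  limUnder atTop fun n : ℕ => Real.log (max ‖H.toFun^[n] p‖ 1) / (H.deg : ℝ) ^ n

/-- The backward escape function `G⁻(p) = lim d⁻ⁿ log⁺ ‖H⁻ⁿ(p)‖`. -/
def Gminus (H : HenonMap) (p : ℂ × ℂ) : ℝ :=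
  limUnder atTop fun n : ℕ => Real.log (max ‖H.invFun^[n] p‖ 1) / (H.deg : ℝ) ^ n

/-- `p` is a periodic saddle point: `H^k(p) = p` for some `k ≥ 1` and `D(H^k)_p` has
an eigenvalue of modulus `< 1` and an eigenvalue of modulus `> 1`. -/
def IsSaddlePeriodic (H : HenonMap) (p : ℂ × ℂ) : Prop :=
  ∃ k : ℕ, 1 ≤ k ∧ H.toFun^[k] p = p ∧
    ∃ (v₁ v₂ : ℂ × ℂ) (μ₁ μ₂ : ℂ), v₁ ≠ 0 ∧ v₂ ≠ 0 ∧
      fderiv ℂ (H.toFun^[k]) p v₁ = μ₁ • v₁ ∧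
      fderiv ℂ (H.toFun^[k]) p v₂ = μ₂ • v₂ ∧
      ‖μ₁‖ < 1 ∧ 1 < ‖μ₂‖

/-- `J*`: the closure of the set of periodic saddle points. -/
def Jstar (H : HenonMap) : Set (ℂ × ℂ) :=
  closure {p | IsSaddlePeriodic H p}

/-- The stable set of a point. -/
def Ws (H : HenonMap) (p : ℂ × ℂ) : Set (ℂ × ℂ) :=
  {x | Tendsto (fun n : ℕ => dist (H.toFun^[n] x) (H.toFun^[n] p)) atTop (𝓝 0)}

/-- The unstable set of a point. -/
def Wu (H : HenonMap) (p : ℂ × ℂ) : Set (ℂ × ℂ) :=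
  {x | Tendsto (fun n : ℕ => dist (H.invFun^[n] x) (H.invFun^[n] p)) atTop (𝓝 0)}

/-- The stable set of a set. -/
def WsSet (H : HenonMap) (S : Set (ℂ × ℂ)) : Set (ℂ × ℂ) :=
  {x | Tendsto (fun n : ℕ => infDist (H.toFun^[n] x) S) atTop (𝓝 0)}

/-- The unstable set of a set. -/
def WuSet (H : HenonMap) (S : Set (ℂ × ℂ)) : Set (ℂ × ℂ) :=
  {x | Tendsto (fun n : ℕ => infDist (H.invFun^[n] x) S) atTop (𝓝 0)}

/-- The local stable set of size `ε`. -/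
def WsLoc (H : HenonMap) (ε : ℝ) (p : ℂ × ℂ) : Set (ℂ × ℂ) :=
  {x | (∀ n : ℕ, dist (H.toFun^[n] x) (H.toFun^[n] p) ≤ ε) ∧
       Tendsto (fun n : ℕ => dist (H.toFun^[n] x) (H.toFun^[n] p)) atTop (𝓝 0)}

/-- The local unstable set of size `ε`. -/
def WuLoc (H : HenonMap) (ε : ℝ) (p : ℂ × ℂ) : Set (ℂ × ℂ) :=
  {x | (∀ n : ℕ, dist (H.invFun^[n] x) (H.invFun^[n] p) ≤ ε) ∧
       Tendsto (fun n : ℕ => dist (H.invFun^[n] x) (H.invFun^[n] p)) atTop (𝓝 0)}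

/-- A parametrization of the stable manifold of `p`: an injective holomorphic immersion
`Φ : ℂ → ℂ²` with `Φ(0) = p` and image `W^s_p`. -/
def IsStableParam (H : HenonMap) (p : ℂ × ℂ) (Φ : ℂ → ℂ × ℂ) : Prop :=
  Differentiable ℂ Φ ∧ Function.Injective Φ ∧ (∀ z, deriv Φ z ≠ 0) ∧
    Φ 0 = p ∧ Set.range Φ = Ws H p

/-- A parametrization of the unstable manifold of `p`. -/
def IsUnstableParam (H : HenonMap) (p : ℂ × ℂ) (Ψ : ℂ → ℂ × ℂ) : Prop :=
  Differentiable ℂ Ψ ∧ Function.Injective Ψ ∧ (∀ z, deriv Ψ z ≠ 0) ∧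
    Ψ 0 = p ∧ Set.range Ψ = Wu H p

/-- Uniform hyperbolicity of `H` on a compact completely invariant set `S`:
a continuous invariant splitting `ℂ² = E^s_x ⊕ E^u_x` into complex lines, with uniform
contraction on `E^s` and uniform expansion on `E^u`.  Continuity of the line fields is
expressed by the closedness of their total spaces over `S` (equivalent to continuity
for fields of lines of constant dimension over a compact set). -/
def UniformlyHyperbolicOn (H : HenonMap) (S : Set (ℂ × ℂ)) : Prop :=
  IsCompact S ∧ H.toFun '' S = S ∧
  ∃ (Es Eu : (ℂ × ℂ) → Submodule ℂ (ℂ × ℂ)) (c lam : ℝ),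
    0 < c ∧ 0 < lam ∧ lam < 1 ∧
    (∀ x ∈ S, Module.finrank ℂ (Es x) = 1) ∧
    (∀ x ∈ S, Module.finrank ℂ (Eu x) = 1) ∧
    (∀ x ∈ S, IsCompl (Es x) (Eu x)) ∧
    IsClosed {q : (ℂ × ℂ) × (ℂ × ℂ) | q.1 ∈ S ∧ q.2 ∈ Es q.1} ∧
    IsClosed {q : (ℂ × ℂ) × (ℂ × ℂ) | q.1 ∈ S ∧ q.2 ∈ Eu q.1} ∧
    (∀ x ∈ S, (Es x).map (fderiv ℂ H.toFun x : (ℂ × ℂ) →ₗ[ℂ] (ℂ × ℂ)) = Es (H.toFun x)) ∧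
    (∀ x ∈ S, (Eu x).map (fderiv ℂ H.toFun x : (ℂ × ℂ) →ₗ[ℂ] (ℂ × ℂ)) = Eu (H.toFun x)) ∧
    (∀ x ∈ S, ∀ v ∈ Es x, ∀ n : ℕ, 1 ≤ n →
      ‖fderiv ℂ (H.toFun^[n]) x v‖ ≤ (lam ^ n / c) * ‖v‖) ∧
    (∀ x ∈ S, ∀ v ∈ Eu x, ∀ n : ℕ, 1 ≤ n →
      ‖fderiv ℂ (H.toFun^[n]) x v‖ ≥ (c / lam ^ n) * ‖v‖)

/-- `p ∈ J*` is weakly stably exposed: there are a parametrization `Φ` of `W^s_p` and a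
nonempty simply connected open set `V ⊂ ℂ` with `0 ∈ ∂V`, `∂V ⊂ J*_{p,s}` and
`Φ(V) ⊂ K ∖ J*`. -/
def WeaklyStablyExposed (H : HenonMap) (p : ℂ × ℂ) : Prop :=
  ∃ (Φ : ℂ → ℂ × ℂ) (V : Set ℂ), IsStableParam H p Φ ∧
    V.Nonempty ∧ IsOpen V ∧ SimplyConnectedSpace V ∧
    (0 : ℂ) ∈ frontier V ∧ frontier V ⊆ Φ ⁻¹' Jstar H ∧
    Φ '' V ⊆ (Kplus H ∩ Kminus H) \ Jstar H

/-- `p ∈ J*` is weakly unstably exposed. -/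
def WeaklyUnstablyExposed (H : HenonMap) (p : ℂ × ℂ) : Prop :=
  ∃ (Ψ : ℂ → ℂ × ℂ) (V : Set ℂ), IsUnstableParam H p Ψ ∧
    V.Nonempty ∧ IsOpen V ∧ SimplyConnectedSpace V ∧
    (0 : ℂ) ∈ frontier V ∧ frontier V ⊆ Ψ ⁻¹' Jstar H ∧
    Ψ '' V ⊆ (Kplus H ∩ Kminus H) \ Jstar H

/-- On an open subset of a complex normed space, the sum of a series of holomorphic functions
dominated by a summable sequence is holomorphic. -/
theorem differentiableOn_tsum_of_norm_le {E : Type*} [NormedAddCommGroup E] [NormedSpace ℂ E]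
    {s : Set E} (hs : IsOpen s) {f : ℕ → E → ℂ} {v : ℕ → ℝ} (hv : Summable v)
    (hf : ∀ n, DifferentiableOn ℂ (f n) s) (hfv : ∀ n, ∀ x ∈ s, ‖f n x‖ ≤ v n) :
    DifferentiableOn ℂ (fun x => ∑' n, f n x) s := by
  intro x hx
  obtain ⟨r, hr, hball⟩ := Metric.isOpen_iff.1 hs x hx
  have hr2 : 0 < r / 2 := half_pos hr
  have hsub : ∀ y ∈ ball x (r / 2), ball y (r / 2) ⊆ s := fun y hy =>
    (ball_subset_ball' (by rw [mem_ball] at hy; linarith)).trans hball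
  have hmem : ∀ y ∈ ball x (r / 2), y ∈ s := fun y hy => hsub y hy (mem_ball_self hr2)
  have hbound : ∀ n, ∀ y ∈ ball x (r / 2), ‖fderiv ℂ (f n) y‖ ≤ 2 * v n / (r / 2) := by
    intro n y hy
    refine Complex.norm_fderiv_le_div_of_mapsTo_ball ((hf n).mono (hsub y hy)) ?_ hr2
    intro z hz
    rw [mem_closedBall, dist_eq_norm]
    linarith [norm_sub_le (f n z) (f n y), hfv n z (hsub y hy hz), hfv n y (hmem y hy)]
  have hsum : Summable fun n => 2 * v n / (r / 2) := (hv.mul_left 2).div_const _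
  let : NormedSpace ℝ E := NormedSpace.restrictScalars ℝ ℂ E
  exact (hasFDerivAt_tsum_of_isPreconnected hsum isOpen_ball
    (convex_ball x (r / 2)).isPreconnected
    (fun n y hy => ((hf n).differentiableAt (hs.mem_nhds (hmem y hy))).hasFDerivAt)
    hbound (mem_ball_self hr2) (Summable.of_norm_bounded hv fun n => hfv n x hx)
    (mem_ball_self hr2)).differentiableAt.differentiableWithinAt

/-- The horizontal escape region `{‖z‖ > R, ‖z‖ > ‖w‖}`. -/
def escapeRegion (R : ℝ) : Set (ℂ × ℂ) := {p | R < ‖p.1‖ ∧ ‖p.2‖ < ‖p.1‖}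

theorem isOpen_escapeRegion (R : ℝ) : IsOpen (escapeRegion R) :=
  (isOpen_lt continuous_const continuous_fst.norm).inter
    (isOpen_lt continuous_snd.norm continuous_fst.norm)

/-- The estimates showing that `F` behaves like a map of degree `d` near the horizontal point at
infinity, expanding there by a factor at least `2 ^ k`, and that the vertical region
`{‖w‖ ≥ R, ‖w‖ ≥ ‖z‖}` is backward invariant. -/
structure EscapeEstimate (F : ℂ × ℂ → ℂ × ℂ) (d k : ℕ) (R : ℝ) : Prop where
  differentiable : Differentiable ℂ F
  mapsTo : MapsTo F (escapeRegion R) (escapeRegion R)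
  growth : ∀ p ∈ escapeRegion R, 2 ^ k * ‖p.1‖ ≤ ‖(F p).1‖
  exists_log : ∃ (u : ℂ × ℂ → ℂ) (M : ℝ), DifferentiableOn ℂ u (escapeRegion R) ∧
    (∀ p ∈ escapeRegion R, ‖u p‖ ≤ M) ∧
    ∀ p ∈ escapeRegion R, (F p).1 = p.1 ^ d * Complex.exp (u p)
  backward : ∀ p, R ≤ ‖(F p).2‖ → ‖(F p).1‖ ≤ ‖(F p).2‖ →
    R ≤ ‖p.2‖ ∧ ‖p.1‖ ≤ ‖p.2‖ ∧ ‖(F p).2‖ ≤ ‖p.2‖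

theorem EscapeEstimate.id (R : ℝ) : EscapeEstimate id 1 0 R where
  differentiable := differentiable_id
  mapsTo := mapsTo_id _
  growth p _ := by simp
  exists_log := ⟨fun _ => 0, 0, differentiableOn_const 0, by simp, by simp⟩
  backward p h₁ h₂ := ⟨h₁, h₂, le_rfl⟩

theorem EscapeEstimate.comp {F G : ℂ × ℂ → ℂ × ℂ} {d e k l : ℕ} {R : ℝ}
    (hF : EscapeEstimate F d k R) (hG : EscapeEstimate G e l R) :
    EscapeEstimate (F ∘ G) (d * e) (k + l) R where
  differentiable := hF.differentiable.comp hG.differentiable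
  mapsTo := hF.mapsTo.comp hG.mapsTo
  growth p hp := by
    have h₁ := hG.growth p hp
    have h₂ := hF.growth (G p) (hG.mapsTo hp)
    calc (2 : ℝ) ^ (k + l) * ‖p.1‖ = 2 ^ k * (2 ^ l * ‖p.1‖) := by ring
      _ ≤ 2 ^ k * ‖(G p).1‖ := by gcongr
      _ ≤ _ := h₂
  exists_log := by
    obtain ⟨u, M, hu, huM, hFu⟩ := hF.exists_log
    obtain ⟨v, N, hv, hvN, hGv⟩ := hG.exists_log
    refine ⟨fun p => d * v p + u (G p), d * N + M,
      (hv.const_mul _).add (hu.comp hG.differentiable.differentiableOn hG.mapsTo), ?_, ?_⟩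
    · intro p hp
      have h₁ := hvN p hp
      have h₂ := huM _ (hG.mapsTo hp)
      calc ‖(d : ℂ) * v p + u (G p)‖ ≤ ‖(d : ℂ) * v p‖ + ‖u (G p)‖ := norm_add_le _ _
        _ ≤ d * N + M := by
          rw [norm_mul, Complex.norm_natCast]
          gcongr
    · intro p hp
      rw [Function.comp_apply, hFu _ (hG.mapsTo hp), hGv p hp, mul_pow, ← pow_mul, mul_comm e d,
        Complex.exp_add, Complex.exp_nat_mul, mul_assoc]
  backward p h₁ h₂ := by
    obtain ⟨a₁, a₂, a₃⟩ := hF.backward (G p) h₁ h₂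
    obtain ⟨b₁, b₂, b₃⟩ := hG.backward p a₁ a₂
    exact ⟨b₁, b₂, a₃.trans b₃⟩

/-- A polynomial differs from its leading term by at most a multiple of `‖z‖ ^ (deg - 1)`. -/
theorem exists_norm_eval_sub_leadingTerm_le (P : Polynomial ℂ) :
    ∃ K : ℝ, 0 ≤ K ∧ ∀ z : ℂ, 1 ≤ ‖z‖ →
      ‖P.eval z - P.leadingCoeff * z ^ P.natDegree‖ ≤ K * ‖z‖ ^ (P.natDegree - 1) := by
  refine ⟨∑ i ∈ Finset.range P.natDegree, ‖P.coeff i‖,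
    Finset.sum_nonneg fun i _ => norm_nonneg _, fun z hz => ?_⟩
  rw [Polynomial.eval_eq_sum_range, Finset.sum_range_succ, Polynomial.leadingCoeff,
    add_sub_cancel_right, Finset.sum_mul]
  refine (norm_sum_le _ _).trans (Finset.sum_le_sum fun i hi => ?_)
  rw [norm_mul, norm_pow]
  have := Finset.mem_range.1 hi
  gcongr ?_ * ?_
  exact pow_le_pow_right₀ hz (by omega)

theorem ElemHenon.leadingCoeff_ne_zero (h : ElemHenon) : h.P.leadingCoeff ≠ 0 := by
  rw [Ne, Polynomial.leadingCoeff_eq_zero]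
  intro h0
  have := h.hdeg
  simp [h0] at this

theorem ElemHenon.exists_norm_le (h : ElemHenon) (M : ℝ) :
    ∃ r : ℝ, 1 ≤ r ∧ ∀ z w : ℂ, r ≤ ‖z‖ → ‖w‖ ≤ ‖z‖ →
      ‖h.P.eval z + h.a * w - h.P.leadingCoeff * z ^ h.P.natDegree‖ ≤
        ‖h.P.leadingCoeff * z ^ h.P.natDegree‖ / 2 ∧
      M * ‖z‖ ≤ ‖h.P.eval z + h.a * w‖ := by
  obtain ⟨K, hK, hle⟩ := exists_norm_eval_sub_leadingTerm_le h.P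
  have hc : 0 < ‖h.P.leadingCoeff‖ := norm_pos_iff.2 h.leadingCoeff_ne_zero
  set c := ‖h.P.leadingCoeff‖
  obtain ⟨e, he⟩ : ∃ e, h.P.natDegree = e + 2 := ⟨_, (Nat.sub_add_cancel h.hdeg).symm⟩
  refine ⟨max 1 (max (2 * (K + ‖h.a‖) / c) (2 * M / c)), le_max_left _ _, fun z w hz hw => ?_⟩
  have hz1 : 1 ≤ ‖z‖ := (le_max_left _ _).trans hz
  have hz2 : 2 * (K + ‖h.a‖) ≤ c * ‖z‖ := by
    rw [← div_le_iff₀' hc]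
    exact ((le_max_left _ _).trans (le_max_right _ _)).trans hz
  have hz3 : 2 * M ≤ c * ‖z‖ := by
    rw [← div_le_iff₀' hc]
    exact ((le_max_right _ _).trans (le_max_right _ _)).trans hz
  have hpow : 1 ≤ ‖z‖ ^ e := one_le_pow₀ hz1
  have hnorm : ‖h.P.leadingCoeff * z ^ h.P.natDegree‖ = c * ‖z‖ ^ (e + 2) := by
    rw [norm_mul, norm_pow, he]
  have hfirst : ‖h.P.eval z + h.a * w - h.P.leadingCoeff * z ^ h.P.natDegree‖ ≤
      ‖h.P.leadingCoeff * z ^ h.P.natDegree‖ / 2 := by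
    have h₁ := hle z hz1
    rw [he, show e + 2 - 1 = e + 1 by omega] at h₁
    have h₂ : ‖h.a * w‖ ≤ ‖h.a‖ * ‖z‖ ^ (e + 1) := by
      rw [norm_mul]
      gcongr
      exact hw.trans (le_self_pow₀ hz1 (by omega))
    have h₃ : 2 * (K + ‖h.a‖) * ‖z‖ ^ (e + 1) ≤ c * ‖z‖ * ‖z‖ ^ (e + 1) := by gcongr
    rw [hnorm, he]
    calc ‖h.P.eval z + h.a * w - h.P.leadingCoeff * z ^ (e + 2)‖
        = ‖(h.P.eval z - h.P.leadingCoeff * z ^ (e + 2)) + h.a * w‖ := by ring_nf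
      _ ≤ K * ‖z‖ ^ (e + 1) + ‖h.a‖ * ‖z‖ ^ (e + 1) := (norm_add_le _ _).trans (add_le_add h₁ h₂)
      _ ≤ c * ‖z‖ ^ (e + 2) / 2 := by
        have : c * ‖z‖ ^ (e + 2) = c * ‖z‖ * ‖z‖ ^ (e + 1) := by ring
        linarith
  refine ⟨hfirst, ?_⟩
  have h₁ := norm_sub_norm_le (h.P.leadingCoeff * z ^ h.P.natDegree) (h.P.eval z + h.a * w)
  rw [norm_sub_rev] at h₁
  have h₂ : 2 * M * ‖z‖ ≤ c * ‖z‖ ^ (e + 2) :=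
    calc 2 * M * ‖z‖ ≤ c * ‖z‖ * ‖z‖ := by gcongr
      _ = c * ‖z‖ ^ 2 * 1 := by ring
      _ ≤ c * ‖z‖ ^ 2 * ‖z‖ ^ e := by gcongr
      _ = _ := by ring
  rw [hnorm] at h₁ hfirst
  linarith

/-- Points within distance `‖y‖ / 2` of `y ≠ 0` have a holomorphic logarithm relative to `y`. -/
theorem div_mem_slitPlane_of_norm_sub_le {x y : ℂ} (hy : y ≠ 0) (hxy : ‖x - y‖ ≤ ‖y‖ / 2) :
    x / y ∈ Complex.slitPlane ∧ ‖Complex.log (x / y)‖ ≤ 3 / 4 := by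
  have hy' : 0 < ‖y‖ := norm_pos_iff.2 hy
  have hsmall : ‖x / y - 1‖ ≤ 1 / 2 := by
    rw [div_sub_one hy, norm_div, div_le_iff₀ hy']
    linarith
  have heq : x / y = 1 + (x / y - 1) := by ring
  constructor
  · rw [heq]
    exact Complex.mem_slitPlane_of_norm_lt_one (by linarith)
  · rw [heq]
    exact (Complex.norm_log_one_add_half_le_self hsmall).trans (by linarith)

theorem ElemHenon.differentiable_toFun (h : ElemHenon) : Differentiable ℂ h.toFun := by
  unfold ElemHenon.toFun
  exact ((h.P.differentiable.comp differentiable_fst).add (differentiable_snd.const_mul _)).prodMk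
    (differentiable_fst.const_mul _)

theorem ElemHenon.exists_escapeEstimate (h : ElemHenon) :
    ∃ R₀ : ℝ, 1 ≤ R₀ ∧ ∀ R, R₀ ≤ R → EscapeEstimate h.toFun h.P.natDegree 1 R := by
  have ha : 0 < ‖h.a‖ := norm_pos_iff.2 h.ha
  have hb : 0 < ‖h.b‖ := norm_pos_iff.2 h.hb
  obtain ⟨r, hr1, hr⟩ := h.exists_norm_le (2 + ‖h.b‖ + ‖h.a‖ * (1 + ‖h.b‖))
  refine ⟨max r (r * ‖h.b‖), hr1.trans (le_max_left _ _), fun R hR => ?_⟩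
  have hrR : r ≤ R := (le_max_left _ _).trans hR
  have hrbR : r * ‖h.b‖ ≤ R := (le_max_right _ _).trans hR
  have hR0 : 0 < R := by linarith
  have hgrow : ∀ p ∈ escapeRegion R, (2 + ‖h.b‖) * ‖p.1‖ ≤ ‖(h.toFun p).1‖ := by
    intro p hp
    refine le_trans ?_ (hr p.1 p.2 (hrR.trans hp.1.le) hp.2.le).2
    exact mul_le_mul_of_nonneg_right (le_add_of_nonneg_right (by positivity)) (norm_nonneg _)
  have hpos : ∀ p ∈ escapeRegion R, 0 < ‖p.1‖ := fun p hp => hR0.trans hp.1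
  refine ⟨h.differentiable_toFun, ?_, ?_, ?_, ?_⟩
  · intro p hp
    have h₁ := hgrow p hp
    have h₂ := hpos p hp
    have h₃ := hp.1
    refine ⟨by nlinarith, ?_⟩
    change ‖h.b * p.1‖ < _
    rw [norm_mul]
    nlinarith
  · intro p hp
    have h₁ := hgrow p hp
    have h₂ := hpos p hp
    nlinarith
  · have hc := h.leadingCoeff_ne_zero
    have hne : ∀ p ∈ escapeRegion R, h.P.leadingCoeff * p.1 ^ h.P.natDegree ≠ 0 := fun p hp =>
      mul_ne_zero hc (pow_ne_zero _ (norm_pos_iff.1 (hpos p hp)))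
    have hlog : ∀ p ∈ escapeRegion R, _ := fun p hp =>
      div_mem_slitPlane_of_norm_sub_le (hne p hp) (hr p.1 p.2 (hrR.trans hp.1.le) hp.2.le).1
    refine ⟨fun p => Complex.log h.P.leadingCoeff + Complex.log
      ((h.P.eval p.1 + h.a * p.2) / (h.P.leadingCoeff * p.1 ^ h.P.natDegree)),
      ‖Complex.log h.P.leadingCoeff‖ + 3 / 4, ?_, ?_, ?_⟩
    · refine (differentiableOn_const _).add (DifferentiableOn.clog ?_ fun p hp => (hlog p hp).1)
      simp_rw [div_eq_mul_inv]
      refine DifferentiableOn.mul ?_ (DifferentiableOn.inv ?_ hne)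
      · exact (differentiable_fst.comp h.differentiable_toFun).differentiableOn
      · exact ((differentiable_fst.pow _).const_mul _).differentiableOn
    · intro p hp
      exact (norm_add_le _ _).trans (add_le_add le_rfl (hlog p hp).2)
    · intro p hp
      rw [Complex.exp_add, Complex.exp_log hc,
        Complex.exp_log (Complex.slitPlane_ne_zero (hlog p hp).1)]
      change h.P.eval p.1 + h.a * p.2 = _
      rw [← mul_assoc, mul_comm (p.1 ^ _), mul_div_cancel₀ _ (hne p hp)]
  · rintro ⟨z, w⟩ h₁ h₂
    change R ≤ ‖h.b * z‖ at h₁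
    change ‖h.P.eval z + h.a * w‖ ≤ ‖h.b * z‖ at h₂
    change R ≤ ‖w‖ ∧ ‖z‖ ≤ ‖w‖ ∧ ‖h.b * z‖ ≤ ‖w‖
    rw [norm_mul] at h₁ h₂ ⊢
    have hrz : r ≤ ‖z‖ := by
      refine le_of_mul_le_mul_left ?_ hb
      linarith
    have h₃ := (hr z 0 hrz (by simp)).2
    rw [mul_zero, add_zero] at h₃
    have h₄ : ‖h.P.eval z‖ ≤ ‖h.P.eval z + h.a * w‖ + ‖h.a‖ * ‖w‖ := by
      rw [← norm_mul]
      exact norm_le_add_norm_add _ _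
    have h₅ : ‖h.a‖ * ((1 + ‖h.b‖) * ‖z‖) ≤ ‖h.a‖ * ‖w‖ := by
      nlinarith [norm_nonneg z]
    have h₆ := le_of_mul_le_mul_left h₅ ha
    have h₇ : 0 ≤ ‖h.b‖ * ‖z‖ := by positivity
    exact ⟨by nlinarith [norm_nonneg z], by nlinarith, by nlinarith [norm_nonneg z]⟩

theorem exists_escapeEstimate_foldr (l : List ElemHenon) :
    ∃ R₀ : ℝ, 1 ≤ R₀ ∧ ∀ R, R₀ ≤ R → EscapeEstimate (l.foldr (fun h f => h.toFun ∘ f) id)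
      (l.map fun h => h.P.natDegree).prod l.length R := by
  induction l with
  | nil => exact ⟨1, le_rfl, fun R _ => EscapeEstimate.id R⟩
  | cons h l ih =>
    obtain ⟨R₁, hR₁, h₁⟩ := ih
    obtain ⟨R₂, -, h₂⟩ := h.exists_escapeEstimate
    refine ⟨max R₁ R₂, hR₁.trans (le_max_left _ _), fun R hR => ?_⟩
    have := (h₂ R ((le_max_right _ _).trans hR)).comp (h₁ R ((le_max_left _ _).trans hR))
    rw [add_comm] at this
    simpa using this

theorem HenonMap.two_le_deg (H : HenonMap) : 2 ≤ H.deg := by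
  obtain ⟨l, hl⟩ := H
  cases l with
  | nil => exact absurd rfl hl
  | cons h l =>
    have : 1 ≤ (l.map fun h => h.P.natDegree).prod := by
      refine Nat.one_le_iff_ne_zero.2 (List.prod_ne_zero ?_)
      simp only [List.mem_map, not_exists, not_and]
      intro x _ hx
      have := x.hdeg
      omega
    have h₂ := h.hdeg
    simp only [HenonMap.deg, List.map_cons, List.prod_cons]
    nlinarith

namespace EscapeEstimate

variable {F : ℂ × ℂ → ℂ × ℂ} {d k : ℕ} {R : ℝ}

theorem iterate_mem (hF : EscapeEstimate F d k R) {p : ℂ × ℂ} (hp : p ∈ escapeRegion R) (n : ℕ) :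
    F^[n] p ∈ escapeRegion R :=
  hF.mapsTo.iterate n hp

theorem pow_mul_le_norm_iterate (hF : EscapeEstimate F d k R) {p : ℂ × ℂ}
    (hp : p ∈ escapeRegion R) (n : ℕ) : (2 ^ k) ^ n * ‖p.1‖ ≤ ‖(F^[n] p).1‖ := by
  induction n with
  | zero => simp
  | succ n ih =>
    rw [Function.iterate_succ_apply']
    refine le_trans ?_ (hF.growth _ (hF.iterate_mem hp n))
    rw [pow_succ', mul_assoc]
    gcongr

/-- An orbit which meets the escape region is unbounded. -/
theorem not_isBounded_orbit (hF : EscapeEstimate F d k R) (hk : k ≠ 0) (hR : 0 < R)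
    {p : ℂ × ℂ} {N : ℕ} (hp : F^[N] p ∈ escapeRegion R) :
    ¬ Bornology.IsBounded (range fun n : ℕ => F^[n] p) := by
  intro hb
  obtain ⟨C, hC⟩ := hb.exists_norm_le
  have hpos : 0 < ‖(F^[N] p).1‖ := hR.trans hp.1
  obtain ⟨n, hn⟩ := pow_unbounded_of_one_lt (C / ‖(F^[N] p).1‖) (one_lt_pow₀ one_lt_two hk)
  rw [div_lt_iff₀ hpos] at hn
  have h₁ := hF.pow_mul_le_norm_iterate hp n
  rw [← Function.iterate_add_apply] at h₁
  have h₂ := hC _ (mem_range_self (n + N))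
  have h₃ := norm_fst_le (F^[n + N] p)
  change ‖F^[n + N] p‖ ≤ C at h₂
  linarith

/-- An unbounded orbit meets the escape region. -/
theorem exists_iterate_mem (hF : EscapeEstimate F d k R) {p : ℂ × ℂ}
    (hp : ¬ Bornology.IsBounded (range fun n : ℕ => F^[n] p)) :
    ∃ N, F^[N] p ∈ escapeRegion R := by
  by_contra! hnot
  have hback : ∀ (n : ℕ) (q : ℂ × ℂ), R ≤ ‖(F^[n] q).2‖ → ‖(F^[n] q).1‖ ≤ ‖(F^[n] q).2‖ →
      ‖(F^[n] q).2‖ ≤ ‖q.2‖ := by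
    intro n
    induction n with
    | zero => intro q _ _; exact le_rfl
    | succ n ih =>
      intro q h₁ h₂
      rw [Function.iterate_succ_apply'] at h₁ h₂ ⊢
      obtain ⟨a₁, a₂, a₃⟩ := hF.backward _ h₁ h₂
      exact a₃.trans (ih q a₁ a₂)
  refine hp (isBounded_iff_forall_norm_le.2 ⟨max R ‖p.2‖, ?_⟩)
  rintro _ ⟨n, rfl⟩
  change ‖F^[n] p‖ ≤ _
  rw [Prod.norm_def]
  have hn := hnot n
  simp only [escapeRegion, mem_ofPred_eq, not_and, not_lt] at hn
  rcases le_or_gt ‖(F^[n] p).1‖ ‖(F^[n] p).2‖ with h | h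
  · rw [max_eq_right h]
    rcases le_total R ‖(F^[n] p).2‖ with h' | h'
    · exact (hback n p h' h).trans (le_max_right _ _)
    · exact h'.trans (le_max_left _ _)
  · rw [max_eq_left h.le]
    refine le_trans ?_ (le_max_left _ _)
    by_contra! h'
    exact absurd (hn h') (not_le.2 h)

/-- On the escape region, the escape function is `log ‖z‖` plus the real part of a holomorphic
function. -/
theorem exists_tendsto (hF : EscapeEstimate F d k R) (hd : 2 ≤ d) (hR : 1 ≤ R) :
    ∃ S : ℂ × ℂ → ℂ, DifferentiableOn ℂ S (escapeRegion R) ∧ ∀ p ∈ escapeRegion R,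
      Tendsto (fun n : ℕ => Real.log (max ‖F^[n] p‖ 1) / (d : ℝ) ^ n) atTop
        (𝓝 (Real.log ‖p.1‖ + (S p).re)) := by
  obtain ⟨u, M, hu, huM, hFu⟩ := hF.exists_log
  have hd' : (2 : ℝ) ≤ d := by exact_mod_cast hd
  have hd0 : (0 : ℝ) < d := by linarith
  have hsum : Summable fun n : ℕ => M / (d : ℝ) ^ (n + 1) := by
    have h₁ : Summable fun n : ℕ => ((d : ℝ)⁻¹) ^ n :=
      summable_geometric_of_lt_one (by positivity) (inv_lt_one_of_one_lt₀ (by linarith))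
    refine (h₁.mul_left (M / d)).congr fun n => ?_
    rw [inv_pow, pow_succ]
    field_simp
  have hbound : ∀ n : ℕ, ∀ p ∈ escapeRegion R,
      ‖u (F^[n] p) / (d : ℂ) ^ (n + 1)‖ ≤ M / (d : ℝ) ^ (n + 1) := by
    intro n p hp
    rw [norm_div, norm_pow, Complex.norm_natCast]
    gcongr
    exact huM _ (hF.iterate_mem hp n)
  refine ⟨fun p => ∑' n : ℕ, u (F^[n] p) / (d : ℂ) ^ (n + 1),
    differentiableOn_tsum_of_norm_le (isOpen_escapeRegion R) hsum (fun n => ?_) hbound, ?_⟩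
  · simp_rw [div_eq_mul_inv]
    exact (hu.comp (hF.differentiable.iterate n).differentiableOn
      (fun p hp => hF.iterate_mem hp n)).mul_const _
  intro p hp
  have hpos : ∀ n : ℕ, 1 < ‖(F^[n] p).1‖ := fun n => hR.trans_lt (hF.iterate_mem hp n).1
  have hnorm : ∀ n : ℕ, max ‖F^[n] p‖ 1 = ‖(F^[n] p).1‖ := fun n => by
    rw [Prod.norm_def, max_eq_left (hF.iterate_mem hp n).2.le, max_eq_left (hpos n).le]
  have hpartial : ∀ n : ℕ, Real.log (max ‖F^[n] p‖ 1) / (d : ℝ) ^ n =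
      Real.log ‖p.1‖ + (∑ i ∈ Finset.range n, u (F^[i] p) / (d : ℂ) ^ (i + 1)).re := by
    intro n
    rw [hnorm]
    induction n with
    | zero => simp
    | succ n ih =>
      have h₁ : u (F^[n] p) / (d : ℂ) ^ (n + 1) = u (F^[n] p) / ((d ^ (n + 1) : ℝ) : ℂ) := by
        push_cast
        rfl
      have h₂ : 0 < ‖(F^[n] p).1‖ := by linarith [hpos n]
      rw [Finset.sum_range_succ, Complex.add_re, ← add_assoc, ← ih, h₁, Complex.div_ofReal_re,
        Function.iterate_succ_apply', hFu _ (hF.iterate_mem hp n), norm_mul, norm_pow,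
        Complex.norm_exp, Real.log_mul (pow_ne_zero _ h₂.ne') (Real.exp_ne_zero _), Real.log_pow,
        Real.log_exp, add_div, pow_succ]
      congr 1
      field_simp
  simp_rw [hpartial]
  have hsummable := Summable.of_norm_bounded hsum fun n => hbound n p hp
  exact ((Complex.continuous_re.tendsto _).comp hsummable.hasSum.tendsto_sum_nat).const_add _

end EscapeEstimate

theorem Gplus_locally_re_holomorphic (H : HenonMap) (p : ℂ × ℂ) (hp : p ∉ Kplus H) :
    ∃ U : Set (ℂ × ℂ), IsOpen U ∧ p ∈ U ∧ U ⊆ (Kplus H)ᶜ ∧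
      ∃ g : ℂ × ℂ → ℂ, DifferentiableOn ℂ g U ∧ ∀ x ∈ U, Gplus H x = (g x).re := by
  obtain ⟨R, hR, hest⟩ := exists_escapeEstimate_foldr H.comps
  have hF : EscapeEstimate H.toFun H.deg H.comps.length R := hest R le_rfl
  have hk : H.comps.length ≠ 0 := fun h => H.ne (List.length_eq_zero_iff.1 h)
  obtain ⟨N, hN⟩ := hF.exists_iterate_mem hp
  obtain ⟨S, hS, hlim⟩ := hF.exists_tendsto H.two_le_deg hR
  have hdiff : Differentiable ℂ H.toFun^[N] := hF.differentiable.iterate N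
  have hfst : Differentiable ℂ fun x => (H.toFun^[N] x).1 := differentiable_fst.comp hdiff
  set z₀ : ℂ := (H.toFun^[N] p).1
  have hz₀' : z₀ ≠ 0 := norm_pos_iff.1 (by linarith [hN.1])
  have hquot : Differentiable ℂ fun x => (H.toFun^[N] x).1 / z₀ := by
    simp_rw [div_eq_mul_inv]
    exact hfst.mul_const _
  refine ⟨H.toFun^[N] ⁻¹' escapeRegion R ∩ (fun x => (H.toFun^[N] x).1 / z₀) ⁻¹' Complex.slitPlane,
    ((isOpen_escapeRegion R).preimage hdiff.continuous).inter
      (Complex.isOpen_slitPlane.preimage hquot.continuous), ⟨hN, ?_⟩, ?_,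
    fun x => (Real.log ‖z₀‖ + Complex.log ((H.toFun^[N] x).1 / z₀) + S (H.toFun^[N] x)) /
      ((H.deg ^ N : ℝ) : ℂ), ?_, ?_⟩
  · change z₀ / z₀ ∈ Complex.slitPlane
    rw [div_self hz₀']
    exact Complex.one_mem_slitPlane
  · exact fun x hx => hF.not_isBounded_orbit hk (by linarith) hx.1
  · simp_rw [div_eq_mul_inv _ ((H.deg ^ N : ℝ) : ℂ)]
    refine DifferentiableOn.mul_const (((differentiableOn_const _).add ?_).add ?_) _
    · exact hquot.differentiableOn.clog fun x hx => hx.2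
    · exact hS.comp hdiff.differentiableOn fun x hx => hx.1
  · intro x hx
    have hx1 : (H.toFun^[N] x).1 ≠ 0 := norm_pos_iff.1 (by linarith [hx.1.1])
    refine Tendsto.limUnder_eq ((tendsto_add_atTop_iff_nat N).1 ?_)
    have h₁ := (hlim _ hx.1).div_const ((H.deg : ℝ) ^ N)
    rw [Complex.div_ofReal_re, Complex.add_re, Complex.add_re, Complex.ofReal_re, Complex.log_re,
      norm_div, Real.log_div (norm_ne_zero_iff.2 hx1) (norm_ne_zero_iff.2 hz₀'), add_sub_cancel]
    refine h₁.congr fun n => ?_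
    rw [← Function.iterate_add_apply, div_div, ← pow_add]

/-- The elementary Hénon map conjugate to the inverse of `h` by the exchange of coordinates. -/
def ElemHenon.swapInv (h : ElemHenon) : ElemHenon where
  P := Polynomial.C (-h.a⁻¹) * h.P.comp (Polynomial.C h.b⁻¹ * Polynomial.X)
  a := h.a⁻¹
  b := h.b⁻¹
  ha := inv_ne_zero h.ha
  hb := inv_ne_zero h.hb
  hdeg := by
    rw [Polynomial.natDegree_C_mul (neg_ne_zero.2 (inv_ne_zero h.ha)), Polynomial.natDegree_comp,
      Polynomial.natDegree_C_mul_X _ (inv_ne_zero h.hb), mul_one]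
    exact h.hdeg

theorem ElemHenon.natDegree_swapInv (h : ElemHenon) : h.swapInv.P.natDegree = h.P.natDegree := by
  rw [ElemHenon.swapInv, Polynomial.natDegree_C_mul (neg_ne_zero.2 (inv_ne_zero h.ha)),
    Polynomial.natDegree_comp, Polynomial.natDegree_C_mul_X _ (inv_ne_zero h.hb), mul_one]

theorem ElemHenon.invFun_swap (h : ElemHenon) (p : ℂ × ℂ) :
    h.invFun p.swap = (h.swapInv.toFun p).swap := by
  ext
  · simp [ElemHenon.invFun, ElemHenon.toFun, ElemHenon.swapInv, div_eq_inv_mul]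
  · simp only [ElemHenon.invFun, ElemHenon.toFun, ElemHenon.swapInv, div_eq_inv_mul,
      Polynomial.eval_mul, Polynomial.eval_C, Polynomial.eval_comp, Polynomial.eval_X,
      Prod.fst_swap, Prod.snd_swap]
    ring

/-- The Hénon map conjugate to the inverse of `H` by the exchange of coordinates. -/
def HenonMap.swapInv (H : HenonMap) : HenonMap where
  comps := (H.comps.map ElemHenon.swapInv).reverse
  ne := by simpa using H.ne

theorem HenonMap.deg_swapInv (H : HenonMap) : H.swapInv.deg = H.deg := by
  simp [HenonMap.deg, HenonMap.swapInv, List.prod_reverse, Function.comp_def,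
    ElemHenon.natDegree_swapInv]

theorem foldl_invFun_swap (l : List ElemHenon) (f g : ℂ × ℂ → ℂ × ℂ)
    (hfg : ∀ p : ℂ × ℂ, f p.swap = (g p).swap) (p : ℂ × ℂ) :
    l.foldl (fun f h => h.invFun ∘ f) f p.swap =
      ((l.map ElemHenon.swapInv).foldl (fun f h => h.toFun ∘ f) g p).swap := by
  induction l generalizing f g with
  | nil => exact hfg p
  | cons h l ih =>
    refine ih _ _ fun q => ?_
    simp only [Function.comp_apply, hfg, ElemHenon.invFun_swap]

theorem HenonMap.invFun_iterate_swap (H : HenonMap) (n : ℕ) (p : ℂ × ℂ) :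
    H.invFun^[n] p.swap = (H.swapInv.toFun^[n] p).swap := by
  have hsemi : Function.Semiconj Prod.swap H.swapInv.toFun H.invFun := fun q => by
    rw [HenonMap.invFun, foldl_invFun_swap H.comps id id (fun _ => rfl), HenonMap.toFun,
      HenonMap.swapInv, List.foldr_reverse]
  exact ((hsemi.iterate_right n) p).symm

theorem norm_prod_swap (p : ℂ × ℂ) : ‖p.swap‖ = ‖p‖ := by
  rw [Prod.norm_def, Prod.norm_def, Prod.fst_swap, Prod.snd_swap, max_comm]

theorem swap_mem_Kminus (H : HenonMap) (p : ℂ × ℂ) : p.swap ∈ Kminus H ↔ p ∈ Kplus H.swapInv := by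
  simp only [Kminus, Kplus, mem_ofPred_eq, isBounded_iff_forall_norm_le, forall_mem_range,
    H.invFun_iterate_swap, norm_prod_swap]

theorem Gminus_swap (H : HenonMap) (p : ℂ × ℂ) : Gminus H p.swap = Gplus H.swapInv p := by
  simp only [Gminus, Gplus, H.invFun_iterate_swap, norm_prod_swap, H.deg_swapInv]

/-- `G⁺` is pluriharmonic on `ℂ² ∖ K⁺`: locally the real part of a holomorphic function;
likewise `G⁻` on `ℂ² ∖ K⁻`. -/
theorem G_pluriharmonic_off_K (H : HenonMap) :
    (∀ p ∉ Kplus H, ∃ U : Set (ℂ × ℂ), IsOpen U ∧ p ∈ U ∧ U ⊆ (Kplus H)ᶜ ∧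
      ∃ g : ℂ × ℂ → ℂ, DifferentiableOn ℂ g U ∧ ∀ x ∈ U, Gplus H x = (g x).re) ∧
    (∀ p ∉ Kminus H, ∃ U : Set (ℂ × ℂ), IsOpen U ∧ p ∈ U ∧ U ⊆ (Kminus H)ᶜ ∧
      ∃ g : ℂ × ℂ → ℂ, DifferentiableOn ℂ g U ∧ ∀ x ∈ U, Gminus H x = (g x).re) := by
  refine ⟨Gplus_locally_re_holomorphic H, fun p hp => ?_⟩
  have hp' : p.swap ∉ Kplus H.swapInv := by
    rwa [← swap_mem_Kminus, Prod.swap_swap]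
  obtain ⟨U, hU, hpU, hUK, g, hg, hgU⟩ := Gplus_locally_re_holomorphic H.swapInv p.swap hp'
  have hswap : Differentiable ℂ (Prod.swap : ℂ × ℂ → ℂ × ℂ) :=
    differentiable_snd.prodMk differentiable_fst
  refine ⟨Prod.swap ⁻¹' U, hU.preimage continuous_swap, hpU, fun x hx => ?_, g ∘ Prod.swap,
    hg.comp hswap.differentiableOn (fun x hx => hx), fun x hx => ?_⟩
  · have := hUK hx
    rwa [mem_compl_iff, ← swap_mem_Kminus, Prod.swap_swap] at this
  · rw [Function.comp_apply, ← hgU _ hx, ← Gminus_swap, Prod.swap_swap]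

end
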